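/- Let X be a bounded distributive lattice and fix a, b ∈ X. Define the ternary product (x y z) := L(x,a,y,b,z). Then for all x, x', y, z', z ∈ X the para-associativity identities hold: ((x x' y) z' z) = (x (x' y z') z) = (x (z' y x') z) = (x x' (y z' z)); moreover the middle multiplication operators are idempotent: (x (x y z) z) = (x y z) and (x (z y x) z) = (x y z) for all x, y, z ∈ X. -/

import Mathlib

/-- The quintary map `L` of a lattice. -/
def latticeL {X : Type*} [Lattice X] (x a y b z : X) : X :=
  (b ⊓ (z ⊔ (a ⊓ y))) ⊔ (z ⊓ (b ⊔ (x ⊓ y))) ⊔ (x ⊓ (a ⊔ (z ⊓ y))) ⊔ (a ⊓ (x ⊔ (b ⊓ y)))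

/-- Prime ideals separate the points of a distributive lattice. -/
theorem eq_of_forall_isPrime_mem_iff {X : Type*} [DistribLattice X] [BoundedOrder X] {u v : X}
    (h : ∀ I : Order.Ideal X, I.IsPrime → (u ∈ I ↔ v ∈ I)) : u = v := by
  have le_of_forall : ∀ {u v : X}, (∀ I : Order.Ideal X, I.IsPrime → v ∈ I → u ∈ I) → u ≤ v := by
    intro u v h
    by_contra huv
    have disj : Disjoint (Order.PFilter.principal u : Set X) (Order.Ideal.principal v : Set X) :=
      Set.disjoint_left.mpr fun _ hu hv => huv (le_trans hu hv)
    obtain ⟨J, hJ, hvJ, hdisj⟩ := DistribLattice.prime_ideal_of_disjoint_filter_ideal disj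
    exact Set.disjoint_left.mp hdisj (le_refl u) (h J hJ (hvJ (le_refl v)))
  exact le_antisymm (le_of_forall fun I hI => (h I hI).mpr) (le_of_forall fun I hI => (h I hI).mp)

theorem Order.Ideal.IsPrime.inf_mem_iff {X : Type*} [Lattice X] {I : Order.Ideal X}
    (hI : I.IsPrime) {u v : X} : u ⊓ v ∈ I ↔ u ∈ I ∨ v ∈ I :=
  ⟨hI.mem_or_mem, Or.rec (I.lower inf_le_left) (I.lower inf_le_right)⟩

/-- Modulo a prime ideal, `latticeL x a y b z` is `x ⊓ y ⊓ z`, `x ⊔ y ⊔ z`, `x` or `z`,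
depending on which of `a` and `b` vanish. -/
theorem latticeL_mem_iff {X : Type*} [Lattice X] {I : Order.Ideal X} (hI : I.IsPrime)
    (x a y b z : X) :
    latticeL x a y b z ∈ I ↔
      (a ∈ I ∧ b ∈ I ∧ (x ∈ I ∨ y ∈ I ∨ z ∈ I)) ∨ (a ∉ I ∧ b ∉ I ∧ x ∈ I ∧ y ∈ I ∧ z ∈ I) ∨
      (a ∉ I ∧ b ∈ I ∧ x ∈ I) ∨ (a ∈ I ∧ b ∉ I ∧ z ∈ I) := by
  simp only [latticeL, Order.Ideal.sup_mem_iff, hI.inf_mem_iff]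
  grind

/-- In a bounded distributive lattice, the ternary product `(x y z) := L(x,a,y,b,z)`
is para-associative, and its middle multiplication operators are idempotent. -/
theorem ternary_para_assoc {X : Type*} [DistribLattice X] [BoundedOrder X] (a b : X) :
    (∀ x x' y z' z : X,
      latticeL (latticeL x a x' b y) a z' b z = latticeL x a (latticeL x' a y b z') b z ∧
      latticeL x a (latticeL x' a y b z') b z = latticeL x a (latticeL z' a y b x') b z ∧
      latticeL x a (latticeL z' a y b x') b z = latticeL x a x' b (latticeL y a z' b z)) ∧
    (∀ x y z : X,
      latticeL x a (latticeL x a y b z) b z = latticeL x a y b z ∧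
      latticeL x a (latticeL z a y b x) b z = latticeL x a y b z) := by
  refine ⟨fun x x' y z' z => ⟨?_, ?_, ?_⟩, fun x y z => ⟨?_, ?_⟩⟩ <;>
    refine eq_of_forall_isPrime_mem_iff fun I hI => ?_ <;>
    by_cases ha : a ∈ I <;> by_cases hb : b ∈ I <;>
    simp only [latticeL_mem_iff hI, ha, hb] <;> grind
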